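/- The abelian complexity function ρ of the ordinary paperfolding word satisfies ρ(n) ≥ 3 for all n ≥ 2; that is, apart from the value ρ(1) = 2, the smallest value taken by ρ is 3. -/

import Mathlib

/-- The ordinary paperfolding word over `{0,1}`, indexed from 1:
writing `n = n' * 2^k` with `n'` odd, `pf n = 0` if `n' ≡ 1 (mod 4)`
and `pf n = 1` if `n' ≡ 3 (mod 4)`.  (The value at `0` is irrelevant.) -/
def pf (n : ℕ) : ℕ := if (n / 2 ^ (n.factorization 2)) % 4 = 1 then 0 else 1

/-- The factor `f_i f_{i+1} ⋯ f_{i+n-1}` of the paperfolding word,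
of length `n`, starting at position `i`. -/
def pfFactor (i n : ℕ) : List ℕ := (List.range n).map (fun j => pf (i + j))

/-- `w` is a factor of the ordinary paperfolding word. -/
def IsPFFactor (w : List ℕ) : Prop := ∃ i : ℕ, 1 ≤ i ∧ w = pfFactor i w.length

/-- The abelian complexity function of the ordinary paperfolding word:
the number of abelian equivalence classes of factors of length `n`,
where the class of a factor `w` is determined by the pair
`(|w|_0, |w|_1)` of numbers of occurrences of `0` and `1` in `w`. -/
noncomputable def ρ (n : ℕ) : ℕ :=
  {p : ℕ × ℕ | ∃ i : ℕ, 1 ≤ i ∧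
    p = ((pfFactor i n).count 0, (pfFactor i n).count 1)}.ncard

/-- `Δ w = |w|_0 - |w|_1`. -/
def Δ (w : List ℕ) : ℤ := (w.count 0 : ℤ) - (w.count 1 : ℤ)

/-- `M n` is the maximum of `Δ w` over all factors `w` of the
paperfolding word of length `n`. -/
noncomputable def M (n : ℕ) : ℤ :=
  sSup {d : ℤ | ∃ i : ℕ, 1 ≤ i ∧ d = Δ (pfFactor i n)}

lemma pf_two_mul {m : ℕ} (hm : 1 ≤ m) : pf (2 * m) = pf m := by
  have hf : (2 * m).factorization 2 = m.factorization 2 + 1 := by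
    rw [Nat.factorization_mul two_ne_zero (by omega)]
    simp [Nat.prime_two.factorization, add_comm]
  unfold pf
  rw [hf, pow_succ', Nat.mul_div_mul_left _ _ two_pos]

lemma pf_two_mul_add_one (t : ℕ) : pf (2 * t + 1) = t % 2 := by
  have hf : (2 * t + 1).factorization 2 = 0 :=
    Nat.factorization_eq_zero_of_not_dvd (by omega)
  unfold pf
  rw [hf, pow_zero, Nat.div_one]
  split_ifs <;> omega

lemma pf_eq_zero_or_one (n : ℕ) : pf n = 0 ∨ pf n = 1 := by
  unfold pf
  split_ifs <;> simp

/-- The letter at position `n`, encoded as `1` for `0` and `-1` for `1`. -/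
def pfSign (n : ℕ) : ℤ := 1 - 2 * pf n

/-- The sum of the signs of the factor of length `n` starting at position `i`. -/
def pfSum (i n : ℕ) : ℤ := ∑ k ∈ Finset.range n, pfSign (i + k)

lemma pfSum_succ (i n : ℕ) : pfSum i (n + 1) = pfSum i n + pfSign (i + n) :=
  Finset.sum_range_succ _ _

lemma pfSign_two_mul {m : ℕ} (hm : 1 ≤ m) : pfSign (2 * m) = pfSign m := by
  simp only [pfSign, pf_two_mul hm]

lemma pfSign_two_mul_add_one (t : ℕ) : pfSign (2 * t + 1) = 1 - 2 * ((t % 2 : ℕ) : ℤ) := by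
  simp only [pfSign, pf_two_mul_add_one]

/-- The letters at odd positions alternate, so their signs sum to `0` or to the first sign. -/
lemma pfSum_two_mul {j : ℕ} (hj : 1 ≤ j) (m : ℕ) :
    pfSum (2 * j) (2 * m) = pfSum j m + ((m % 2 : ℕ) : ℤ) * (1 - 2 * ((j % 2 : ℕ) : ℤ)) := by
  induction m with
  | zero => simp [pfSum]
  | succ m ih =>
    rw [show 2 * (m + 1) = 2 * m + 1 + 1 by ring, pfSum_succ, pfSum_succ, ih, pfSum_succ,
      show 2 * j + 2 * m = 2 * (j + m) by ring, pfSign_two_mul (by omega),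
      show 2 * j + (2 * m + 1) = 2 * (j + m) + 1 by ring, pfSign_two_mul_add_one]
    rcases Nat.mod_two_eq_zero_or_one m with hm | hm <;>
      rcases Nat.mod_two_eq_zero_or_one j with hj' | hj' <;>
        simp [Nat.add_mod, hm, hj'] <;> ring

lemma pfSum_two_mul_add_one (j m : ℕ) :
    pfSum (2 * j + 1) (2 * m) =
      pfSum (j + 1) m + ((m % 2 : ℕ) : ℤ) * (1 - 2 * ((j % 2 : ℕ) : ℤ)) := by
  induction m with
  | zero => simp [pfSum]
  | succ m ih =>
    rw [show 2 * (m + 1) = 2 * m + 1 + 1 by ring, pfSum_succ, pfSum_succ, ih, pfSum_succ,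
      show 2 * j + 1 + (2 * m + 1) = 2 * (j + 1 + m) by ring, pfSign_two_mul (by omega),
      show 2 * j + 1 + 2 * m = 2 * (j + m) + 1 by ring, pfSign_two_mul_add_one]
    rcases Nat.mod_two_eq_zero_or_one m with hm | hm <;>
      rcases Nat.mod_two_eq_zero_or_one j with hj' | hj' <;>
        simp [Nat.add_mod, hm, hj'] <;> ring

/-- Some factor of length `n` has sign sum `d`. -/
def IsPFSum (n : ℕ) (d : ℤ) : Prop := ∃ i, 1 ≤ i ∧ pfSum i n = d

lemma IsPFSum.four_mul {k : ℕ} {d : ℤ} (h : IsPFSum (2 * k) d) : IsPFSum (4 * k) d := by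
  obtain ⟨j, hj, rfl⟩ := h
  refine ⟨2 * j, by omega, ?_⟩
  rw [show 4 * k = 2 * (2 * k) by ring, pfSum_two_mul hj]
  simp

lemma IsPFSum.four_mul_add_one {k : ℕ} {d : ℤ} (h : IsPFSum (2 * k + 1) d) :
    IsPFSum (4 * k + 1) d := by
  obtain ⟨j, hj, rfl⟩ := h
  refine ⟨2 * j, by omega, ?_⟩
  rw [show 4 * k = 2 * (2 * k) by ring, pfSum_succ, pfSum_two_mul hj, ← mul_add,
    pfSign_two_mul (by omega), pfSum_succ]
  simp

lemma IsPFSum.four_mul_add_three {k : ℕ} {d : ℤ} (h : IsPFSum (2 * k + 1) d) :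
    IsPFSum (4 * k + 3) d := by
  obtain ⟨j, hj, rfl⟩ := h
  obtain ⟨j, rfl⟩ := Nat.exists_eq_add_of_le' hj
  refine ⟨2 * j + 1, by omega, ?_⟩
  rw [show 4 * k + 3 = 2 * (2 * k + 1) + 1 by ring, pfSum_succ, pfSum_two_mul_add_one,
    show 2 * j + 1 + 2 * (2 * k + 1) = 2 * (j + 2 * k + 1) + 1 by ring, pfSign_two_mul_add_one]
  rcases Nat.mod_two_eq_zero_or_one j with hj' | hj' <;> simp [Nat.add_mod, hj']

lemma IsPFSum.four_mul_add_two {k : ℕ} {d : ℤ} (h : IsPFSum (2 * k + 1) d) :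
    IsPFSum (4 * k + 2) (d + 1) ∧ IsPFSum (4 * k + 2) (d - 1) := by
  obtain ⟨j, hj, rfl⟩ := h
  obtain ⟨j, rfl⟩ := Nat.exists_eq_add_of_le' hj
  have h₀ := pfSum_two_mul hj (2 * k + 1)
  have h₁ := pfSum_two_mul_add_one j (2 * k + 1)
  rw [show 4 * k + 2 = 2 * (2 * k + 1) by ring]
  rw [show (2 * k + 1) % 2 = 1 by omega] at h₀ h₁
  rcases Nat.mod_two_eq_zero_or_one j with hj' | hj'
  · rw [show (j + 1) % 2 = 1 by omega] at h₀
    rw [hj'] at h₁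
    norm_num at h₀ h₁
    exact ⟨⟨_, by omega, h₁⟩, ⟨_, by omega, h₀⟩⟩
  · rw [show (j + 1) % 2 = 0 by omega] at h₀
    rw [hj'] at h₁
    norm_num at h₀ h₁
    exact ⟨⟨_, by omega, h₀⟩, ⟨_, by omega, h₁⟩⟩

lemma pfSign_initial_values : pfSign 1 = 1 ∧ pfSign 2 = 1 ∧ pfSign 3 = -1 ∧ pfSign 5 = 1 ∧
    pfSign 6 = -1 ∧ pfSign 7 = -1 ∧ pfSign 8 = 1 ∧ pfSign 9 = 1 ∧ pfSign 10 = 1 := by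
  have e (m : ℕ) (hm : 1 ≤ m) := pfSign_two_mul hm
  have o := pfSign_two_mul_add_one
  have h1 := o 0
  have h2 := e 1 (by simp)
  have h3 := o 1
  have h4 := e 2 (by simp)
  have h5 := o 2
  have h6 := e 3 (by simp)
  have h7 := o 3
  have h8 := e 4 (by simp)
  have h9 := o 4
  have h10 := e 5 (by simp)
  norm_num at *
  simp_all

lemma isPFSum_odd (k : ℕ) :
    IsPFSum (2 * k + 3) (-1) ∧ IsPFSum (2 * k + 3) 1 ∧ IsPFSum (2 * k + 3) 3 := by
  induction k using Nat.strong_induction_on with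
  | _ k ih =>
    obtain rfl | hk := Nat.eq_zero_or_pos k
    · obtain ⟨h1, h2, h3, h5, h6, h7, h8, h9, h10⟩ := pfSign_initial_values
      refine ⟨⟨5, ?_⟩, ⟨1, ?_⟩, ⟨8, ?_⟩⟩ <;> simp [pfSum, Finset.sum_range_succ, *]
    · obtain ⟨l, rfl | rfl⟩ := Nat.even_or_odd' k
      · obtain ⟨a, b, c⟩ := ih (l - 1) (by omega)
        rw [show 2 * (l - 1) + 3 = 2 * l + 1 by omega] at a b c
        rw [show 2 * (2 * l) + 3 = 4 * l + 3 by ring]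
        exact ⟨a.four_mul_add_three, b.four_mul_add_three, c.four_mul_add_three⟩
      · obtain ⟨a, b, c⟩ := ih l (by omega)
        rw [show 2 * (2 * l + 1) + 3 = 4 * (l + 1) + 1 by ring]
        exact ⟨IsPFSum.four_mul_add_one a, IsPFSum.four_mul_add_one b,
          IsPFSum.four_mul_add_one c⟩

lemma isPFSum_even (k : ℕ) :
    IsPFSum (2 * k + 2) (-2) ∧ IsPFSum (2 * k + 2) 0 ∧ IsPFSum (2 * k + 2) 2 := by
  induction k using Nat.strong_induction_on with
  | _ k ih =>
    obtain rfl | hk := Nat.eq_zero_or_pos k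
    · obtain ⟨h1, h2, h3, h5, h6, h7, h8, h9, h10⟩ := pfSign_initial_values
      refine ⟨⟨6, ?_⟩, ⟨2, ?_⟩, ⟨1, ?_⟩⟩ <;> simp [pfSum, Finset.sum_range_succ, *]
    · obtain ⟨l, rfl | rfl⟩ := Nat.even_or_odd' k
      · obtain ⟨a, b, -⟩ := isPFSum_odd (l - 1)
        rw [show 2 * (l - 1) + 3 = 2 * l + 1 by omega] at a b
        rw [show 2 * (2 * l) + 2 = 4 * l + 2 by ring]
        exact ⟨a.four_mul_add_two.2, b.four_mul_add_two.2, b.four_mul_add_two.1⟩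
      · obtain ⟨a, b, c⟩ := ih l (by omega)
        rw [show 2 * (2 * l + 1) + 2 = 4 * (l + 1) by ring]
        exact ⟨IsPFSum.four_mul a, IsPFSum.four_mul b, IsPFSum.four_mul c⟩

lemma pfSum_eq_count (i n : ℕ) : pfSum i n = n - 2 * ((pfFactor i n).count 1 : ℤ) := by
  induction n with
  | zero => simp [pfSum, pfFactor]
  | succ n ih =>
    have hc : (pfFactor i (n + 1)).count 1 = (pfFactor i n).count 1 + pf (i + n) := by
      rcases pf_eq_zero_or_one (i + n) with h | h <;>
        simp [pfFactor, List.range_succ, h]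
    rw [pfSum_succ, ih, hc, pfSign]
    push_cast
    ring

/-- The pairs `(|w|₀, |w|₁)` over the factors `w` of length `n`. -/
def pfParikh (n : ℕ) : Set (ℕ × ℕ) :=
  {p | ∃ i : ℕ, 1 ≤ i ∧ p = ((pfFactor i n).count 0, (pfFactor i n).count 1)}

lemma pfParikh_finite (n : ℕ) : (pfParikh n).Finite := by
  refine (Set.finite_Iic (n, n)).subset ?_
  rintro _ ⟨i, -, rfl⟩
  have h (a : ℕ) : (pfFactor i n).count a ≤ n :=
    List.count_le_length.trans_eq (by simp [pfFactor])
  exact ⟨h 0, h 1⟩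

lemma three_le_rho {n : ℕ} {a b c : ℤ} (ha : IsPFSum n a) (hb : IsPFSum n b)
    (hc : IsPFSum n c) (hab : a < b) (hbc : b < c) : 3 ≤ ρ n := by
  change 3 ≤ (pfParikh n).ncard
  obtain ⟨i, hi, rfl⟩ := ha
  obtain ⟨j, hj, rfl⟩ := hb
  obtain ⟨k, hk, rfl⟩ := hc
  simp only [pfSum_eq_count] at hab hbc
  refine (Set.two_lt_ncard (pfParikh_finite n)).2
    ⟨_, ⟨i, hi, rfl⟩, _, ⟨j, hj, rfl⟩, _, ⟨k, hk, rfl⟩, ?_, ?_, ?_⟩ <;>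
  · intro h
    have := (Prod.ext_iff.1 h).2
    simp only at this
    omega

lemma rho_one : ρ 1 = 2 := by
  have h : pfParikh 1 = {(1, 0), (0, 1)} := by
    ext p
    simp only [pfParikh, Set.mem_ofPred_eq, Set.mem_insert_iff, Set.mem_singleton_iff]
    constructor
    · rintro ⟨i, -, rfl⟩
      rcases pf_eq_zero_or_one i with h | h <;> simp [pfFactor, h]
    · rintro (rfl | rfl)
      · exact ⟨1, le_rfl, by simp [pfFactor, show pf 1 = 0 from pf_two_mul_add_one 0]⟩
      · exact ⟨3, by simp, by simp [pfFactor, show pf 3 = 1 from pf_two_mul_add_one 1]⟩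
  change (pfParikh 1).ncard = 2
  rw [h, Set.ncard_pair (by simp)]

/-- `ρ(1) = 2` and `ρ(n) ≥ 3` for all `n ≥ 2`. -/
theorem pf_rho_ge_three : ρ 1 = 2 ∧ ∀ n : ℕ, 2 ≤ n → 3 ≤ ρ n := by
  refine ⟨rho_one, fun n hn => ?_⟩
  obtain ⟨m, rfl⟩ := Nat.exists_eq_add_of_le' hn
  obtain ⟨k, rfl | rfl⟩ := Nat.even_or_odd' m
  · obtain ⟨a, b, c⟩ := isPFSum_even k
    exact three_le_rho a b c (by simp) (by simp)
  · obtain ⟨a, b, c⟩ := isPFSum_odd k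
    exact three_le_rho a b c (by simp) (by simp)
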